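/- In any algebra (S,*,') satisfying the three axioms, the identity x'' * x' = x * x' holds for all x in S. -/

import Mathlib

theorem stmt (S : Type*) (m : S → S → S) (i : S → S)
    (E1 : ∀ x, m (m x (i x)) x = x)
    (E2 : ∀ x y, m (m x (i x)) (m (i y) y) = m (m (i y) y) (m x (i x)))
    (E3 : ∀ x y z, m (m x y) z = m x (m y (i (i z)))) :
    ∀ x, m (i (i x)) (i x) = m x (i x) := by
  have mul_cancel (x y : S) : m (m (m x (i (i y))) (i y)) y = m x (i (i y)) := by
    rw [E3 x, E3 x, E1]
  have inv_mul_inv_inv (x : S) : m (i x) (i (i x)) = m (i x) x := by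
    rw [← mul_cancel (i x) x, E1]
  have inv_mul_mul_inv (x : S) : m (m (i x) x) (i x) = i x := by
    rw [← inv_mul_inv_inv, E1]
  have assoc_inv_self (x y : S) : m (m x (i y)) y = m x (m (i y) y) := by
    rw [E3, inv_mul_inv_inv]
  have mul_inv_mul (x : S) : m x (m (i x) x) = x := by
    rw [← assoc_inv_self, E1]
  have inv_inv_mul_mul (x : S) : m (m (i (i x)) (i x)) x = i (i x) := by
    have h := mul_cancel (m (i (i x)) (i (i (i x)))) x
    rwa [E1] at h
  have inv_inv_inv_mul_inv_inv (x : S) :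
      m (i (i (i x))) (i (i x)) = m (i (i (i x))) x := by
    rw [← mul_cancel (i (i (i x))) x, inv_inv_mul_mul]
  have idem_comm (x y : S) :
      m (m (i x) x) (m (i y) y) = m (m (i y) y) (m (i x) x) := by
    rw [← inv_mul_inv_inv x, E2]
  have assoc_idem (x y z : S) :
      m x (m y (m (i (i (i z))) z)) = m (m x y) (m (i z) z) := by
    rw [← inv_inv_inv_mul_inv_inv, ← assoc_inv_self, ← E3, ← E3, assoc_inv_self]
  have mul_inv_inv_mul_idem (x y : S) :
      m (m x (i (i y))) (m (i y) y) = m x (i (i y)) := by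
    rw [← assoc_idem, ← inv_inv_inv_mul_inv_inv, mul_inv_mul]
  have idem_mul_idem (x : S) :
      m (m (i x) x) (m (i (i (i x))) (i (i x))) = m (i (i (i x))) (i (i x)) := by
    rw [idem_comm, mul_inv_inv_mul_idem]
  have idem_mul_inv_inv_inv (x : S) : m (m (i x) x) (i (i (i x))) = i (i (i x)) := by
    have h := mul_cancel (m (i x) x) (i x)
    rwa [assoc_inv_self _ (i (i x)), idem_mul_idem, inv_inv_mul_mul, eq_comm] at h
  have inv_inv_inv (x : S) : i (i (i x)) = i x := by
    have h := E3 (m (i x) x) (m (i x) x) (i x)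
    rwa [← assoc_inv_self, inv_mul_mul_inv, inv_mul_mul_inv, idem_mul_inv_inv_inv,
      idem_mul_inv_inv_inv, eq_comm] at h
  have assoc_inv (x y z : S) : m (m x y) (i z) = m x (m y (i z)) := by
    rw [E3, inv_inv_inv]
  have mul_inv_inv (x y : S) : m x (i (i y)) = m x y := by
    calc m x (i (i y)) = m (m x (m (i x) x)) (i (i y)) := by rw [mul_inv_mul]
      _ = m (m x (m (i x) x)) y := by rw [assoc_inv, ← E3]
      _ = m x y := by rw [mul_inv_mul]
  have assoc (x y z : S) : m (m x y) z = m x (m y z) := by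
    rw [E3, mul_inv_inv]
  intro x
  calc m (i (i x)) (i x) = m (m (i (i x)) (i x)) (m x (i x)) := by
        rw [assoc, ← assoc (i x), inv_mul_mul_inv]
    _ = m (m x (i x)) (m (i (i x)) (i x)) := (E2 x (i x)).symm
    _ = m x (i x) := by rw [assoc, mul_inv_mul]
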